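/- arXiv:1005.4576 — 2 statements merged into one kernel-verified Lean document; each statement's English description precedes it below -/
import Mathlib

section
/- Let E be a finite-dimensional vector space over a field K, let P be a subspace of F²(T(E)) = K·1 ⊕ E ⊕ E⊗E, and let 𝔄 = T(E)/(P) be the corresponding nonhomogeneous quadratic algebra with quadratic part A = T(E)/(R), where R is the image of P under the projection of F²(T(E)) onto E⊗E. If the canonical surjection can: A → gr(𝔄) is an isomorphism (the PBW property), then: (i) P ∩ F¹(T(E)) = 0, and (ii) (P·E + E·P) ∩ F²(T(E)) ⊆ P. -/
/-!
STATEMENT 4: Let `E` be a finite-dimensional vector space over a field `K`, let `P` be a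
subspace of `F²(T(E)) = K·1 ⊕ E ⊕ E⊗E`, and let `𝔄 = T(E)/(P)` with quadratic part
`A = T(E)/(R)`, where `R` is the image of `P` under the projection of `F²(T(E))` onto
`E⊗E`.  If the canonical surjection `can : A → gr(𝔄)` is an isomorphism (the PBW property)
then (i) `P ∩ F¹(T(E)) = 0` and (ii) `(P·E + E·P) ∩ F²(T(E)) ⊆ P`.

Encodings.  `Tₙ = E^{⊗n} ⊆ T(E)`; `R` (the image of `P` under the projection of `F²` onto
the degree-2 component) is `(P ⊔ F¹(T(E))) ⊓ T₂`; the PBW property is encoded degreewise: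
`can` is an isomorphism of graded algebras iff `Tₙ ⊓ ((P) ⊔ Fⁿ⁻¹(T(E))) = (R) ⊓ Tₙ` for
all `n` (in degree `n`, `can` is the surjection
`Tₙ/((R) ∩ Tₙ) → Fⁿ(T(E))/(Fⁿ⁻¹(T(E)) + (P) ∩ Fⁿ(T(E)))` induced by `Tₙ ⊆ Fⁿ(T(E))`).
`P·E` and `E·P` are the products of submodules `P * T₁` and `T₁ * P`.
-/

noncomputable section

open TensorAlgebra TensorProduct

variable (K E : Type) [Field K] [AddCommGroup E] [Module K E]

/-- The tensor algebra `T(E)`. -/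
abbrev T := TensorAlgebra K E

/-- The canonical inclusion `E → T(E)`. -/
abbrev ιE : E →ₗ[K] T K E := TensorAlgebra.ι K

/-- The degree-`n` homogeneous component `E^{⊗n} ⊆ T(E)`. -/
def Tdeg (n : ℕ) : Submodule K (T K E) := LinearMap.range (ιE K E) ^ n

/-- The filtration `Fⁿ(T(E)) = ⊕_{m ≤ n} E^{⊗m}` of the tensor algebra. -/
def FT : ℕ → Submodule K (T K E)
  | 0 => Tdeg K E 0
  | n + 1 => FT n ⊔ Tdeg K E (n + 1)

/-- `F^{n-1}(T(E))`, with the convention `F^{-1} = 0`. -/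
def FTpred : ℕ → Submodule K (T K E)
  | 0 => ⊥
  | n + 1 => FT K E n

/-- The two-sided ideal of `T(E)` generated by a subset `S`, as a `K`-submodule. -/
def idl (S : Set (T K E)) : Submodule K (T K E) :=
  Submodule.span K {z | ∃ a b : T K E, ∃ p ∈ S, z = a * p * b}

/-- The Poincaré–Birkhoff–Witt property for `𝔄 = T(E)/(P)` with quadratic part
`A = T(E)/(R)`: the canonical surjection `can : A → gr(𝔄)` is an isomorphism of graded
algebras, expressed degreewise (see the discussion above). -/
def PBWproperty (P R : Set (T K E)) : Prop :=
  ∀ n : ℕ, Tdeg K E n ⊓ (idl K E P ⊔ FTpred K E n) = idl K E R ⊓ Tdeg K E n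

/-- The projection of the tensor algebra onto its degree-`n` component. -/
def homComp (n : ℕ) : T K E →ₗ[K] T K E :=
  GradedAlgebra.proj (fun i : ℕ => LinearMap.range (ιE K E) ^ i) n

variable {K E}

theorem mem_Tdeg_zero {x : T K E} (hx : x ∈ Tdeg K E 0) : ∃ c : K, x = algebraMap K _ c := by
  rw [Tdeg, pow_zero, Submodule.mem_one] at hx
  obtain ⟨c, rfl⟩ := hx
  exact ⟨c, rfl⟩

theorem homComp_of_mem_same {n : ℕ} {x : T K E} (hx : x ∈ Tdeg K E n) : homComp K E n x = x :=
  DirectSum.decompose_of_mem_same (fun i : ℕ => LinearMap.range (ιE K E) ^ i) hx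

theorem homComp_mem (n : ℕ) (x : T K E) : homComp K E n x ∈ Tdeg K E n :=
  SetLike.coe_mem _

theorem homComp_mul_right {i : ℕ} (n : ℕ) (a : T K E) {b : T K E} (hb : b ∈ Tdeg K E i) :
    homComp K E n (a * b) = if i ≤ n then homComp K E (n - i) a * b else 0 :=
  DirectSum.coe_decompose_mul_of_right_mem (fun i : ℕ => LinearMap.range (ιE K E) ^ i) n hb

/-- For `R ⊆ E ⊗ E`, the ideal generated by `R` vanishes in degrees `< 2` and equals `R` in
degree `2`. -/
theorem homComp_idl {R : Submodule K (T K E)} (hR : R ≤ Tdeg K E 2) {z : T K E}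
    (hz : z ∈ idl K E (R : Set (T K E))) :
    (∀ n < 2, homComp K E n z = 0) ∧ homComp K E 2 z ∈ R := by
  induction hz using Submodule.span_induction with
  | zero => simp
  | add x y _ _ hx hy =>
    refine ⟨fun n hn => by rw [map_add, hx.1 n hn, hy.1 n hn, add_zero], ?_⟩
    rw [map_add]
    exact R.add_mem hx.2 hy.2
  | smul c x _ hx =>
    refine ⟨fun n hn => by rw [map_smul, hx.1 n hn, smul_zero], ?_⟩
    rw [map_smul]
    exact R.smul_mem c hx.2
  | mem x hx =>
    obtain ⟨a, b, r, hr, rfl⟩ := hx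
    have hlow : ∀ n < 2, homComp K E n (a * r) = 0 := fun n hn => by
      rw [homComp_mul_right n a (hR hr), if_neg (by omega)]
    have htwo : homComp K E 2 (a * r) ∈ R := by
      rw [homComp_mul_right 2 a (hR hr), if_pos le_rfl]
      obtain ⟨c, hc⟩ := mem_Tdeg_zero (homComp_mem (2 - 2) a)
      rw [hc, ← Algebra.smul_def]
      exact R.smul_mem c hr
    generalize a * r = y at hlow htwo
    induction b using DirectSum.Decomposition.inductionOn
      (fun i : ℕ => LinearMap.range (ιE K E) ^ i) with
    | zero => simp
    | add b b' h h' =>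
      rw [mul_add]
      refine ⟨fun n hn => by rw [map_add, h.1 n hn, h'.1 n hn, add_zero], ?_⟩
      rw [map_add]
      exact R.add_mem h.2 h'.2
    | @homogeneous i b =>
      refine ⟨fun n hn => ?_, ?_⟩
      · rw [homComp_mul_right n y b.2, hlow (n - i) (by omega)]
        simp
      · rw [homComp_mul_right 2 y b.2]
        rcases Nat.eq_zero_or_pos i with rfl | hi
        · obtain ⟨c, hc⟩ := mem_Tdeg_zero b.2
          rw [hc, ← Algebra.commutes, ← Algebra.smul_def, if_pos (Nat.zero_le 2)]
          exact R.smul_mem c htwo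
        · rw [hlow (2 - i) (by omega)]
          simp

theorem subset_idl (S : Set (T K E)) : S ⊆ idl K E S := fun p hp =>
  Submodule.subset_span ⟨1, 1, p, hp, by simp⟩

theorem mul_Tdeg_le_idl (P : Submodule K (T K E)) (n : ℕ) :
    P * Tdeg K E n ≤ idl K E (P : Set (T K E)) :=
  Submodule.mul_le.2 fun p hp b _ => Submodule.subset_span ⟨1, b, p, hp, by simp⟩

theorem Tdeg_mul_le_idl (P : Submodule K (T K E)) (n : ℕ) :
    Tdeg K E n * P ≤ idl K E (P : Set (T K E)) :=
  Submodule.mul_le.2 fun a _ p hp => Submodule.subset_span ⟨a, 1, p, hp, by simp⟩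

/-- Under the PBW property, if `R ⊆ E ⊗ E`, the ideal `(P)` meets `F¹` trivially. -/
theorem idl_inf_FT_one {P R : Submodule K (T K E)} (hR : R ≤ Tdeg K E 2)
    (hPBW : PBWproperty K E (P : Set (T K E)) (R : Set (T K E))) :
    idl K E (P : Set (T K E)) ⊓ FT K E 1 = ⊥ := by
  have hvan : ∀ n < 2, ∀ x ∈ Tdeg K E n,
      x ∈ idl K E (P : Set (T K E)) ⊔ FTpred K E n → x = 0 := fun n hn x hx hx' => by
    have h : x ∈ idl K E (R : Set (T K E)) ⊓ Tdeg K E n := hPBW n ▸ ⟨hx, hx'⟩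
    rw [← homComp_of_mem_same hx, (homComp_idl hR h.1).1 n hn]
  rw [eq_bot_iff]
  rintro x ⟨hxP, hx⟩
  obtain ⟨x₀, h₀, x₁, h₁, rfl⟩ := Submodule.mem_sup.1 hx
  have hx₁ : x₁ = 0 := hvan 1 (by norm_num) x₁ h₁
    (Submodule.mem_sup.2 ⟨_, hxP, -x₀, Submodule.neg_mem _ h₀, by abel⟩)
  rw [hx₁, add_zero] at hxP ⊢
  exact hvan 0 (by norm_num) x₀ h₀ (Submodule.mem_sup_left hxP)

variable (K E)

theorem stmt_4 [FiniteDimensional K E]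
    (P : Submodule K (T K E))
    (hPF2 : P ≤ FT K E 2)
    -- `R` = image of `P` under the canonical projection of `F²(T(E))` onto `E⊗E`
    (R : Submodule K (T K E))
    (hR : R = (P ⊔ FT K E 1) ⊓ Tdeg K E 2)
    -- `𝔄` has the PBW property
    (hPBW : PBWproperty K E (P : Set (T K E)) (R : Set (T K E))) :
    P ⊓ FT K E 1 = ⊥ ∧
      (P * Tdeg K E 1 ⊔ Tdeg K E 1 * P) ⊓ FT K E 2 ≤ P := by
  subst hR
  have hbot := idl_inf_FT_one inf_le_right hPBW
  refine ⟨eq_bot_iff.2 (hbot ▸ inf_le_inf_right _ (subset_idl _)), ?_⟩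
  rintro x ⟨hx, hxF⟩
  replace hx : x ∈ idl K E (P : Set (T K E)) :=
    sup_le (mul_Tdeg_le_idl P 1) (Tdeg_mul_le_idl P 1) hx
  obtain ⟨f, hf, t, ht, rfl⟩ := Submodule.mem_sup.1 hxF
  have hmem : t ∈ idl K E (((P ⊔ FT K E 1) ⊓ Tdeg K E 2 : Submodule K (T K E)) : Set (T K E)) ⊓
      Tdeg K E 2 :=
    hPBW 2 ▸ ⟨ht, Submodule.mem_sup.2 ⟨_, hx, -f, Submodule.neg_mem _ hf, by abel⟩⟩
  have htR := (homComp_idl inf_le_right hmem.1).2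
  rw [homComp_of_mem_same ht] at htR
  obtain ⟨p, hp, g, hg, rfl⟩ := Submodule.mem_sup.1 htR.1
  have hfg : f + g ∈ idl K E (P : Set (T K E)) ⊓ FT K E 1 := by
    refine ⟨?_, add_mem hf hg⟩
    have := sub_mem hx (subset_idl _ hp)
    rwa [show f + (p + g) - p = f + g by abel] at this
  rw [hbot, Submodule.mem_bot] at hfg
  rwa [show f + (p + g) = p + (f + g) by abel, hfg, add_zero]

end
end

section
/- Let K be a field of characteristic different from 2, E a finite-dimensional K-vector space, θ ∈ E* a linear form and g a symmetric bilinear form on E. Let 𝔄 = T(E)/(P) where P = span{x⊗y + y⊗x − θ(x)y − θ(y)x − 2g(x,y)·1 : x,y ∈ E} ⊆ K·1 ⊕ E ⊕ E⊗E, equipped with the filtration induced from Fⁿ(T(E)) = ⊕_{m≤n} E^{⊗m}. Then 𝔄 has the PBW property: the canonical surjective homomorphism of graded algebras can: ∧E → gr(𝔄) from the exterior algebra ∧E is an isomorphism. -/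
/-!
STATEMENT 19: Let `K` be a field of characteristic ≠ 2, `E` a finite-dimensional
`K`-vector space, `θ ∈ E*` and `g` a symmetric bilinear form on `E`.  Let
`𝔄 = T(E)/(P)` with `P = span{x⊗y + y⊗x − θ(x)y − θ(y)x − 2g(x,y)·1}`.  Then `𝔄` has the
PBW property: the canonical surjection `can : ∧E → gr(𝔄)` is an isomorphism.

Encodings.  The quadratic part of `𝔄` is `∧E = T(E)/(R)` with `R = span{x⊗y + y⊗x}`
(the image of `P` under the projection of `F²(T(E))` onto `E ⊗ E`).  `can` is an
isomorphism of graded algebras iff degreewise `Tₙ ⊓ ((P) ⊔ Fⁿ⁻¹(T(E))) = (R) ⊓ Tₙ`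
(in degree `n`, `can` is the surjection
`Tₙ/((R) ∩ Tₙ) → Fⁿ(T(E))/(Fⁿ⁻¹(T(E)) + (P) ∩ Fⁿ(T(E)))` induced by `Tₙ ⊆ Fⁿ(T(E))`).
-/

noncomputable section

open TensorAlgebra TensorProduct

variable (K E : Type) [Field K] [AddCommGroup E] [Module K E]

section Ideal

variable {K E}

theorem mul_mem_idl_left (S : Set (T K E)) (c : T K E) {z : T K E} (hz : z ∈ idl K E S) :
    c * z ∈ idl K E S := by
  induction hz using Submodule.span_induction with
  | mem x hx =>
    obtain ⟨a, b, p, hp, rfl⟩ := hx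
    exact Submodule.subset_span ⟨c * a, b, p, hp, by simp only [mul_assoc]⟩
  | zero => simp
  | add x y _ _ hx hy => rw [mul_add]; exact add_mem hx hy
  | smul k x _ hx => rw [mul_smul_comm]; exact Submodule.smul_mem _ k hx

theorem mul_mem_idl_right (S : Set (T K E)) (c : T K E) {z : T K E} (hz : z ∈ idl K E S) :
    z * c ∈ idl K E S := by
  induction hz using Submodule.span_induction with
  | mem x hx =>
    obtain ⟨a, b, p, hp, rfl⟩ := hx
    exact Submodule.subset_span ⟨a, b * c, p, hp, by simp only [mul_assoc]⟩
  | zero => simp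
  | add x y _ _ hx hy => rw [add_mul]; exact add_mem hx hy
  | smul k x _ hx => rw [smul_mul_assoc]; exact Submodule.smul_mem _ k hx

theorem map_eq_zero_of_mem_idl {A : Type} [Ring A] [Algebra K A] {S : Set (T K E)} (f : T K E →ₐ[K] A)
    (hf : ∀ p ∈ S, f p = 0) {z : T K E} (hz : z ∈ idl K E S) : f z = 0 := by
  induction hz using Submodule.span_induction with
  | mem x hx =>
    obtain ⟨a, b, p, hp, rfl⟩ := hx
    simp [hf p hp]
  | zero => simp
  | add x y _ _ hx hy => rw [map_add, hx, hy, add_zero]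
  | smul k x _ hx => rw [map_smul, hx, smul_zero]

/-- The submodule `idl K E S` as a bundled two-sided ideal. -/
def idlTwoSided (S : Set (T K E)) : TwoSidedIdeal (T K E) :=
  TwoSidedIdeal.mk' (idl K E S) (zero_mem _) add_mem neg_mem
    (mul_mem_idl_left S _) (mul_mem_idl_right S _)

/-- The quotient algebra `T(E)/(S)`. -/
abbrev IdlQuotient (S : Set (T K E)) := (idlTwoSided S).ringCon.Quotient

/-- The projection `T(E) → T(E)/(S)`. -/
def idlMk (S : Set (T K E)) : T K E →ₐ[K] IdlQuotient S := RingCon.mkₐ K _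

theorem idlMk_eq_zero_iff (S : Set (T K E)) (z : T K E) : idlMk S z = 0 ↔ z ∈ idl K E S := by
  rw [← map_zero (idlMk S)]
  refine (RingCon.eq _).trans ?_
  rw [← TwoSidedIdeal.mem_iff]
  exact TwoSidedIdeal.mem_mk' ..

end Ideal

section Clifford

variable {K E}
variable (l : Module.Dual K E) (g : E →ₗ[K] E →ₗ[K] K)

/-- The relation `x⊗y + y⊗x − 2l(x)y − 2l(y)x − 2g(x,y)·1`. -/
def cliffordRel (p : E × E) : T K E :=
  ιE K E p.1 * ιE K E p.2 + ιE K E p.2 * ιE K E p.1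
    - (2 * l p.1) • ιE K E p.2 - (2 * l p.2) • ιE K E p.1
    - algebraMap K (T K E) (2 * g p.1 p.2)

/-- The quadratic form `x ↦ g(x,x) + l(x)²`. -/
def shiftedForm : QuadraticForm K E :=
  LinearMap.BilinMap.toQuadraticMap (g + l.smulRight l)

theorem shiftedForm_apply (x : E) : shiftedForm l g x = g x x + l x * l x := by
  simp [shiftedForm]

/-- The algebra map from `T(E)` to the Clifford algebra of `shiftedForm l g` that sends a
vector `x` to `x + l(x)·1`. -/
def shiftedToClifford : T K E →ₐ[K] CliffordAlgebra (shiftedForm l g) :=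
  TensorAlgebra.lift K (CliffordAlgebra.ι _ + (Algebra.linearMap K _).comp l)

@[simp]
theorem shiftedToClifford_ι (x : E) :
    shiftedToClifford l g (ιE K E x) = CliffordAlgebra.ι _ x + algebraMap K _ (l x) := by
  simp [shiftedToClifford]

theorem shiftedToClifford_cliffordRel (hg : ∀ x y : E, g x y = g y x) (p : E × E) :
    shiftedToClifford l g (cliffordRel l g p) = 0 := by
  obtain ⟨x, y⟩ := p
  have h := CliffordAlgebra.ι_mul_ι_add_swap (Q := shiftedForm l g) x y
  have hp : QuadraticMap.polar (shiftedForm l g) x y = 2 * g x y + 2 * (l x * l y) := by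
    simp only [QuadraticMap.polar, shiftedForm_apply, map_add, LinearMap.add_apply, hg y x]
    ring
  rw [hp] at h
  simp only [cliffordRel, map_sub, map_add, map_mul, shiftedToClifford_ι, map_smul, AlgHom.commutes]
  simp only [Algebra.smul_def, map_mul, map_add, map_ofNat] at h ⊢
  have hx := Algebra.commutes (l x) (CliffordAlgebra.ι (shiftedForm l g) y)
  have hy := Algebra.commutes (l y) (CliffordAlgebra.ι (shiftedForm l g) x)
  have hxy := Algebra.commutes (l y) (algebraMap K (CliffordAlgebra (shiftedForm l g)) (l x))
  generalize CliffordAlgebra.ι (shiftedForm l g) x = X at *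
  generalize CliffordAlgebra.ι (shiftedForm l g) y = Y at *
  generalize algebraMap K (CliffordAlgebra (shiftedForm l g)) (l x) = a at *
  generalize algebraMap K (CliffordAlgebra (shiftedForm l g)) (l y) = b at *
  have : (X + a) * (Y + b) + (Y + b) * (X + a) =
      (X * Y + Y * X) + (X * b + b * X) + (a * Y + Y * a) + (a * b + b * a) := by noncomm_ring
  rw [this, h, ← hx, ← hy, mul_add (2 * b), mul_assoc 2 b a, hxy]
  noncomm_ring

theorem shiftedToClifford_eq_zero_iff (h2 : (2 : K) ≠ 0) (hg : ∀ x y : E, g x y = g y x)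
    (z : T K E) : shiftedToClifford l g z = 0 ↔ z ∈ idl K E (Set.range (cliffordRel l g)) := by
  refine ⟨fun hz => ?_, map_eq_zero_of_mem_idl _ (by rintro _ ⟨p, rfl⟩; exact shiftedToClifford_cliffordRel l g hg p)⟩
  let S := Set.range (cliffordRel l g)
  let f : E →ₗ[K] IdlQuotient S :=
    (idlMk S).toLinearMap.comp (ιE K E) - (Algebra.linearMap K _).comp l
  have hf : ∀ x, f x * f x = algebraMap K _ (shiftedForm l g x) := fun x => by
    have hr : idlMk S (cliffordRel l g (x, x)) = 0 :=
      (idlMk_eq_zero_iff S _).2 (subset_idl S ⟨_, rfl⟩)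
    have hd : cliffordRel l g (x, x) = (2 : K) • (ιE K E x * ιE K E x - (2 * l x) • ιE K E x
        - algebraMap K _ (g x x)) := by
      simp only [cliffordRel, two_smul, two_mul, add_smul, map_add]
      abel
    rw [hd, map_smul, smul_eq_zero_iff_right h2] at hr
    have hc := Algebra.commutes (l x) (idlMk S (ιE K E x))
    simp only [map_sub, map_mul, AlgHom.commutes, Algebra.smul_def, map_ofNat] at hr
    simp only [f, LinearMap.sub_apply, LinearMap.comp_apply, AlgHom.toLinearMap_apply,
      Algebra.linearMap_apply, shiftedForm_apply, map_add, map_mul]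
    generalize idlMk S (ιE K E x) = X at *
    generalize algebraMap K (IdlQuotient S) (l x) = a at *
    rw [sub_eq_zero] at hr
    rw [← hr, sub_mul, mul_sub, mul_sub, ← hc]
    noncomm_ring
  have hcomp : (CliffordAlgebra.lift _ ⟨f, hf⟩).comp (shiftedToClifford l g) = idlMk S := by
    refine TensorAlgebra.hom_ext (LinearMap.ext fun x => ?_)
    have := shiftedToClifford_ι l g x
    simp only [LinearMap.comp_apply, AlgHom.toLinearMap_apply, AlgHom.comp_apply, this, map_add,
      CliffordAlgebra.lift_ι_apply, AlgHom.commutes]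
    simp [f]
  rw [← idlMk_eq_zero_iff, ← hcomp, AlgHom.comp_apply, hz, map_zero]

end Clifford

section Filtration

variable {K E}

theorem Tdeg_le_FT (n : ℕ) : Tdeg K E n ≤ FT K E n := by
  cases n with
  | zero => exact le_rfl
  | succ n => exact le_sup_right

theorem FT_mono : Monotone (FT K E) := monotone_nat_of_le_succ fun _ => le_sup_left

theorem FTpred_le_FT (n : ℕ) : FTpred K E n ≤ FT K E n := by
  cases n with
  | zero => exact bot_le
  | succ n => exact le_sup_left

theorem Tdeg_succ_induction {n : ℕ} {N : Submodule K (T K E)}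
    (h : ∀ x, ∀ t ∈ Tdeg K E n, ιE K E x * t ∈ N) : Tdeg K E (n + 1) ≤ N := by
  rw [Tdeg, pow_succ', Submodule.mul_le]
  rintro _ ⟨x, rfl⟩ t ht
  exact h x t ht

theorem ι_mul_mem_Tdeg (x : E) {n : ℕ} {t : T K E} (ht : t ∈ Tdeg K E n) :
    ιE K E x * t ∈ Tdeg K E (n + 1) := by
  rw [Tdeg, pow_succ']
  exact Submodule.mul_mem_mul ⟨x, rfl⟩ ht

theorem FT_induction {N : ℕ → Submodule K (T K E)} (hN : Monotone N)
    (h : ∀ n, Tdeg K E n ≤ N n) (n : ℕ) : FT K E n ≤ N n := by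
  induction n with
  | zero => exact h 0
  | succ n ih => exact sup_le (ih.trans (hN n.le_succ)) (h _)

theorem ι_mul_mem_FT (x : E) (n : ℕ) :
    FT K E n ≤ (FT K E (n + 1)).comap (LinearMap.mulLeft K (ιE K E x)) :=
  FT_induction (N := fun n => (FT K E (n + 1)).comap (LinearMap.mulLeft K (ιE K E x)))
    (fun _ _ hab => Submodule.comap_mono (FT_mono (Nat.succ_le_succ hab)))
    (fun n _ ht => Tdeg_le_FT (n + 1) (ι_mul_mem_Tdeg x ht)) n

variable (K E)

/-- The filtration of the exterior algebra by degree. -/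
def exteriorFiltration (n : ℕ) : Submodule K (ExteriorAlgebra K E) :=
  (FT K E n).map (toExterior (R := K) (M := E)).toLinearMap

/-- The filtration of the exterior algebra by degree, shifted by one. -/
def exteriorFiltrationPred (n : ℕ) : Submodule K (ExteriorAlgebra K E) :=
  (FTpred K E n).map (toExterior (R := K) (M := E)).toLinearMap

variable {K E}

theorem exteriorFiltration_mono : Monotone (exteriorFiltration K E) := fun _ _ h =>
  Submodule.map_mono (FT_mono h)

theorem exteriorFiltrationPred_le (n : ℕ) :
    exteriorFiltrationPred K E n ≤ exteriorFiltration K E n :=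
  Submodule.map_mono (FTpred_le_FT n)

theorem toExterior_mem_filtration {n : ℕ} {t : T K E} (ht : t ∈ Tdeg K E n) :
    toExterior t ∈ exteriorFiltration K E n :=
  ⟨t, Tdeg_le_FT n ht, rfl⟩

theorem ι_mul_mem_exteriorFiltration (x : E) {n : ℕ} {u : ExteriorAlgebra K E}
    (hu : u ∈ exteriorFiltration K E n) :
    ExteriorAlgebra.ι K x * u ∈ exteriorFiltration K E (n + 1) := by
  obtain ⟨t, ht, rfl⟩ := hu
  exact ⟨ιE K E x * t, ι_mul_mem_FT x n ht, by simp⟩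

theorem toExterior_mem_exteriorPower {n : ℕ} {t : T K E} (ht : t ∈ Tdeg K E n) :
    toExterior t ∈ ⋀[K]^n E := by
  have h : (Tdeg K E n).map (toExterior (R := K) (M := E)).toLinearMap = ⋀[K]^n E := by
    rw [Tdeg, Submodule.map_pow, ← LinearMap.range_comp]
    congr 2
    ext x
    simp
  exact h ▸ Submodule.mem_map_of_mem ht

theorem toExterior_eq_zero_of_mem_pred {n : ℕ} {t : T K E} (ht : t ∈ Tdeg K E n)
    (h : toExterior t ∈ exteriorFiltrationPred K E n) : toExterior t = 0 := by
  let π := GradedRing.proj (fun i : ℕ => ⋀[K]^i E) n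
  have hlow : ∀ m < n, ∀ s ∈ FT K E m, π (toExterior s) = 0 := by
    intro m
    induction m with
    | zero =>
      intro hm s hs
      exact DirectSum.decompose_of_mem_ne (fun i : ℕ => ⋀[K]^i E) (toExterior_mem_exteriorPower hs) hm.ne
    | succ m ih =>
      intro hm s hs
      obtain ⟨a, ha, b, hb, rfl⟩ := Submodule.mem_sup.1 hs
      rw [map_add, map_add, ih (by omega) a ha, zero_add]
      exact DirectSum.decompose_of_mem_ne (fun i : ℕ => ⋀[K]^i E) (toExterior_mem_exteriorPower hb) hm.ne
  have hn : π (toExterior t) = toExterior t :=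
    DirectSum.decompose_of_mem_same (fun i : ℕ => ⋀[K]^i E) (toExterior_mem_exteriorPower ht)
  obtain ⟨s, hs, hst⟩ := h
  cases n with
  | zero =>
    rw [← hst, (Submodule.mem_bot K).1 hs, map_zero]
  | succ n =>
    rw [← hn, ← hst]
    exact hlow n n.lt_succ_self s hs

theorem contractLeft_mem_exteriorFiltration (d : Module.Dual K E) {n : ℕ}
    {u : ExteriorAlgebra K E} (hu : u ∈ exteriorFiltration K E n) :
    CliffordAlgebra.contractLeft (Q := (0 : QuadraticForm K E)) d u ∈
      exteriorFiltration K E n := by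
  let c : ExteriorAlgebra K E →ₗ[K] ExteriorAlgebra K E :=
    CliffordAlgebra.contractLeft (Q := (0 : QuadraticForm K E)) d
  let f := c.comp (toExterior (R := K) (M := E)).toLinearMap
  have hdeg : ∀ n, Tdeg K E n ≤ (exteriorFiltration K E n).comap f := by
    intro n
    induction n with
    | zero =>
      intro t ht
      rw [Tdeg, pow_zero, Submodule.mem_one] at ht
      obtain ⟨k, rfl⟩ := ht
      have : f (algebraMap K _ k) = 0 := by
        change c (toExterior (algebraMap K _ k)) = 0
        rw [AlgHom.commutes]
        exact CliffordAlgebra.contractLeft_algebraMap _ d k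
      rw [Submodule.mem_comap, this]
      exact zero_mem _
    | succ n ih =>
      refine Tdeg_succ_induction fun x t ht => ?_
      have : f (ιE K E x * t) = d x • toExterior t - ExteriorAlgebra.ι K x * f t := by
        change c (toExterior (ιE K E x * t)) = _
        rw [map_mul, toExterior_ι]
        exact CliffordAlgebra.contractLeft_ι_mul d x _
      rw [Submodule.mem_comap, this]
      exact sub_mem (Submodule.smul_mem _ _ (exteriorFiltration_mono n.le_succ
        (toExterior_mem_filtration ht))) (ι_mul_mem_exteriorFiltration x (ih ht))
  obtain ⟨t, ht, rfl⟩ := hu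
  exact FT_induction (N := fun n => (exteriorFiltration K E n).comap f)
    (fun _ _ h => Submodule.comap_mono (exteriorFiltration_mono h)) hdeg n ht

end Filtration

section Symbol

variable {K E}
variable (l : Module.Dual K E) (g : E →ₗ[K] E →ₗ[K] K)

theorem neg_toQuadraticMap_eq :
    LinearMap.BilinMap.toQuadraticMap (-(g + l.smulRight l)) =
      (0 : QuadraticForm K E) - shiftedForm l g := by
  rw [LinearMap.BilinMap.toQuadraticMap_neg, zero_sub, shiftedForm]

/-- The composition of `shiftedToClifford` with the linear isomorphism onto the exterior algebra. -/
def cliffordSymbol : T K E →ₗ[K] ExteriorAlgebra K E :=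
  (CliffordAlgebra.changeForm (neg_toQuadraticMap_eq l g)).comp (shiftedToClifford l g).toLinearMap

theorem cliffordSymbol_eq_zero_iff (z : T K E) :
    cliffordSymbol l g z = 0 ↔ shiftedToClifford l g z = 0 :=
  (CliffordAlgebra.changeFormEquiv (neg_toQuadraticMap_eq l g)).map_eq_zero_iff

theorem cliffordSymbol_algebraMap (k : K) :
    cliffordSymbol l g (algebraMap K _ k) = algebraMap K _ k := by
  change CliffordAlgebra.changeForm (neg_toQuadraticMap_eq l g)
    (shiftedToClifford l g (algebraMap K _ k)) = _
  rw [AlgHom.commutes]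
  exact CliffordAlgebra.changeForm_algebraMap _ k

theorem cliffordSymbol_ι_mul (x : E) (t : T K E) :
    cliffordSymbol l g (ιE K E x * t) = ExteriorAlgebra.ι K x * cliffordSymbol l g t
      - CliffordAlgebra.contractLeft (Q := (0 : QuadraticForm K E))
        ((-(g + l.smulRight l)) x) (cliffordSymbol l g t)
      + l x • cliffordSymbol l g t := by
  change CliffordAlgebra.changeForm (neg_toQuadraticMap_eq l g)
    (shiftedToClifford l g (ιE K E x * t)) = _
  rw [map_mul, shiftedToClifford_ι, add_mul, map_add, CliffordAlgebra.changeForm_ι_mul,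
    ← Algebra.smul_def, map_smul]
  rfl

theorem cliffordSymbol_sub_mem {n : ℕ} {t : T K E} (ht : t ∈ Tdeg K E n) :
    cliffordSymbol l g t - toExterior t ∈ exteriorFiltrationPred K E n := by
  let D := cliffordSymbol l g - (toExterior (R := K) (M := E)).toLinearMap
  suffices h : Tdeg K E n ≤ (exteriorFiltrationPred K E n).comap D from h ht
  clear ht t
  induction n with
  | zero =>
    intro t ht
    rw [Tdeg, pow_zero, Submodule.mem_one] at ht
    obtain ⟨k, rfl⟩ := ht
    have : D (algebraMap K _ k) = 0 := by
      simp [D, cliffordSymbol_algebraMap]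
    rw [Submodule.mem_comap, this]
    exact zero_mem _
  | succ n ih =>
    refine Tdeg_succ_induction fun x t ht => ?_
    have hD : D t ∈ exteriorFiltrationPred K E n := ih ht
    have hS : cliffordSymbol l g t ∈ exteriorFiltration K E n := by
      have := add_mem (exteriorFiltrationPred_le n hD) (toExterior_mem_filtration ht)
      simpa [D] using this
    have hxD : ExteriorAlgebra.ι K x * D t ∈ exteriorFiltration K E n := by
      cases n with
      | zero =>
        obtain ⟨s, hs, hst⟩ := hD
        rw [← hst, (Submodule.mem_bot K).1 hs, map_zero, mul_zero]
        exact zero_mem _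
      | succ n => exact ι_mul_mem_exteriorFiltration x hD
    have : D (ιE K E x * t) = ExteriorAlgebra.ι K x * D t
        - CliffordAlgebra.contractLeft (Q := (0 : QuadraticForm K E))
          ((-(g + l.smulRight l)) x) (cliffordSymbol l g t)
        + l x • cliffordSymbol l g t := by
      simp only [D, LinearMap.sub_apply, cliffordSymbol_ι_mul, AlgHom.toLinearMap_apply, map_mul,
        toExterior_ι, mul_sub]
      abel
    rw [Submodule.mem_comap, this]
    exact add_mem (sub_mem hxD (contractLeft_mem_exteriorFiltration _ hS))
      (Submodule.smul_mem _ _ hS)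

theorem map_cliffordSymbol_FT (n : ℕ) :
    (FT K E n).map (cliffordSymbol l g) = exteriorFiltration K E n := by
  apply le_antisymm
  · rw [Submodule.map_le_iff_le_comap]
    refine FT_induction (N := fun n => (exteriorFiltration K E n).comap (cliffordSymbol l g))
      (fun _ _ h => Submodule.comap_mono (exteriorFiltration_mono h)) (fun n t ht => ?_) n
    have := add_mem (exteriorFiltrationPred_le n (cliffordSymbol_sub_mem l g ht))
      (toExterior_mem_filtration ht)
    simpa using this
  · have hdeg : ∀ n, exteriorFiltrationPred K E n ≤ (FT K E n).map (cliffordSymbol l g) →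
        ∀ t ∈ Tdeg K E n, toExterior t ∈ (FT K E n).map (cliffordSymbol l g) := by
      intro n hn t ht
      have := sub_mem (Submodule.mem_map_of_mem (f := cliffordSymbol l g) (Tdeg_le_FT n ht))
        (hn (cliffordSymbol_sub_mem l g ht))
      simpa using this
    induction n with
    | zero =>
      rintro _ ⟨t, ht, rfl⟩
      refine hdeg 0 ?_ t ht
      rintro _ ⟨s, hs, rfl⟩
      rw [(Submodule.mem_bot K).1 hs, map_zero]
      exact zero_mem _
    | succ n ih =>
      have hle := ih.trans (Submodule.map_mono (f := cliffordSymbol l g) (FT_mono n.le_succ))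
      rintro _ ⟨t, ht, rfl⟩
      obtain ⟨a, ha, b, hb, rfl⟩ := Submodule.mem_sup.1 ht
      rw [map_add]
      exact add_mem (hle ⟨a, ha, rfl⟩) (hdeg (n + 1) hle b hb)

theorem map_cliffordSymbol_FTpred (n : ℕ) :
    (FTpred K E n).map (cliffordSymbol l g) = exteriorFiltrationPred K E n := by
  cases n with
  | zero => simp [exteriorFiltrationPred, FTpred]
  | succ n => exact map_cliffordSymbol_FT l g n

theorem toExterior_eq_zero_iff (h2 : (2 : K) ≠ 0) (z : T K E) :
    toExterior z = 0 ↔ z ∈ idl K E (Set.range (cliffordRel (0 : Module.Dual K E) 0)) := by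
  let e : (shiftedForm (0 : Module.Dual K E) 0).IsometryEquiv (0 : QuadraticForm K E) :=
    { LinearEquiv.refl K E with map_app' := fun x => by simp [shiftedForm_apply] }
  let e' := CliffordAlgebra.equivOfIsometry e
  have he : e'.toAlgHom.comp (shiftedToClifford 0 0) = toExterior := by
    refine TensorAlgebra.hom_ext (LinearMap.ext fun x => ?_)
    have h1 : e' (CliffordAlgebra.ι _ x) = ExteriorAlgebra.ι K x :=
      CliffordAlgebra.map_apply_ι e.toIsometry x
    have h2 := shiftedToClifford_ι (0 : Module.Dual K E) 0 x
    simp_all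
  rw [← shiftedToClifford_eq_zero_iff 0 0 h2 (fun _ _ => rfl), ← he]
  exact e'.map_eq_zero_iff

theorem PBWproperty_cliffordRel (h2 : (2 : K) ≠ 0) (hg : ∀ x y : E, g x y = g y x) :
    PBWproperty K E (Set.range (cliffordRel l g))
      (Set.range (cliffordRel (0 : Module.Dual K E) 0)) := by
  intro n
  ext t
  simp only [Submodule.mem_inf, and_comm (b := t ∈ Tdeg K E n), ← toExterior_eq_zero_iff h2]
  refine and_congr_right fun ht => ?_
  have hD := cliffordSymbol_sub_mem l g ht
  have hker (z) : z ∈ idl K E (Set.range (cliffordRel l g)) ↔ cliffordSymbol l g z = 0 := by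
    rw [cliffordSymbol_eq_zero_iff, shiftedToClifford_eq_zero_iff l g h2 hg]
  constructor
  · intro h
    obtain ⟨p, hp, f, hf, rfl⟩ := Submodule.mem_sup.1 h
    refine toExterior_eq_zero_of_mem_pred ht ?_
    rw [map_add (cliffordSymbol l g), (hker p).1 hp, zero_add] at hD
    have := sub_mem ((map_cliffordSymbol_FTpred l g n).le ⟨f, hf, rfl⟩) hD
    simpa using this
  · intro h
    rw [h, sub_zero, ← map_cliffordSymbol_FTpred l g n] at hD
    obtain ⟨f, hf, hft⟩ := hD
    refine Submodule.mem_sup.2 ⟨t - f, (hker _).2 ?_, f, hf, sub_add_cancel t f⟩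
    rw [map_sub, hft, sub_self]

end Symbol

theorem stmt_19 [FiniteDimensional K E]
    (hchar : (2 : K) ≠ 0)  -- `K` has characteristic different from 2
    (θ : Module.Dual K E)
    (g : E →ₗ[K] E →ₗ[K] K)
    (hg : ∀ x y : E, g x y = g y x)  -- `g` is a symmetric bilinear form
    -- the space of relations of `𝔄`:
    -- `P = span{x⊗y + y⊗x − θ(x)y − θ(y)x − 2g(x,y)·1 | x, y ∈ E}`
    (P : Set (T K E))
    (hP : P = Set.range fun p : E × E =>
      ιE K E p.1 * ιE K E p.2 + ιE K E p.2 * ιE K E p.1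
        - θ p.1 • ιE K E p.2 - θ p.2 • ιE K E p.1
        - algebraMap K (T K E) (2 * g p.1 p.2))
    -- the space of relations of the exterior algebra `∧E`: `R = span{x⊗y + y⊗x}`
    (R : Set (T K E))
    (hR : R = Set.range fun p : E × E =>
      ιE K E p.1 * ιE K E p.2 + ιE K E p.2 * ιE K E p.1) :
    PBWproperty K E P R := by
  have h2 : ∀ x, 2 * ((2 : K)⁻¹ • θ) x = θ x := fun x => by
    simp [mul_inv_cancel_left₀ hchar]
  have hP' : P = Set.range (cliffordRel ((2 : K)⁻¹ • θ) g) := by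
    rw [hP]
    congr 1
    funext p
    simp only [cliffordRel, h2]
  have hR' : R = Set.range (cliffordRel (0 : Module.Dual K E) 0) := by
    rw [hR]
    congr 1
    funext p
    simp [cliffordRel]
  rw [hP', hR']
  exact PBWproperty_cliffordRel _ g hchar hg

end
end
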